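/- There exists a constant C > 0 such that for all integers n ≥ 1 and all integers k with 1 ≤ k ≤ n, setting α = j_{n+1,k} and β = j_{n,k}, one has |J_{n−1}(αx)| ≤ C · |J_n(α)| for every real x with β/α < x < 1. -/

import Mathlib

open Real MeasureTheory intervalIntegral

/-- The Bessel function of the first kind of (integer) order `n`, defined by its
everywhere-convergent power series. -/
noncomputable def besselJ (n : ℕ) (x : ℝ) : ℝ :=
  ∑' m : ℕ, ((-1 : ℝ) ^ m / (Nat.factorial m * Nat.factorial (m + n))) * (x / 2) ^ (2 * m + n)

/-- `x` is the `k`-th positive zero of `f` (for `k ≥ 1`): `x` is a positive zero of `f`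
and there are exactly `k - 1` positive zeros of `f` below `x`. -/
def IsKthPosZero (f : ℝ → ℝ) (k : ℕ) (x : ℝ) : Prop :=
  0 < x ∧ f x = 0 ∧ {y : ℝ | 0 < y ∧ y < x ∧ f y = 0}.ncard = k - 1

/-- coefficients of the reduced Bessel series -/
noncomputable def bcoef (n m : ℕ) : ℝ := (-1 : ℝ) ^ m / (Nat.factorial m * Nat.factorial (m + n))

/-- reduced Bessel function -/
noncomputable def bF (n : ℕ) (y : ℝ) : ℝ := ∑' m : ℕ, bcoef n m * y ^ m

lemma abs_bcoef_le (n m : ℕ) : |bcoef n m| ≤ 1 / Nat.factorial m := by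
  unfold bcoef
  rw [abs_div, abs_pow, abs_neg, abs_one, one_pow]
  have h1 : (1 : ℝ) ≤ Nat.factorial (m + n) := by exact_mod_cast Nat.factorial_pos _
  have h2 : (0 : ℝ) < Nat.factorial m := by exact_mod_cast Nat.factorial_pos _
  rw [abs_of_pos (by positivity)]
  apply one_div_le_one_div_of_le h2
  nlinarith

lemma bF_summable (n : ℕ) (y : ℝ) : Summable fun m => bcoef n m * y ^ m := by
  apply Summable.of_norm_bounded (Real.summable_pow_div_factorial |y|)
  intro m
  rw [Real.norm_eq_abs, abs_mul, abs_pow]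
  calc _ ≤ (1 / (Nat.factorial m : ℝ)) * |y| ^ m := by gcongr; exact abs_bcoef_le n m
    _ = _ := by ring

lemma bcoef_succ (n m : ℕ) : bcoef n (m + 1) * ((m + 1 : ℕ) : ℝ) = - bcoef (n + 1) m := by
  unfold bcoef
  have h2 : ((m + 1 : ℕ) : ℝ) ≠ 0 := by positivity
  have h3 : (Nat.factorial m : ℝ) ≠ 0 := by positivity
  have h4 : (Nat.factorial (m + (n + 1)) : ℝ) ≠ 0 := by positivity
  rw [show m + 1 + n = m + (n + 1) by ring, Nat.factorial_succ m, Nat.cast_mul]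
  field_simp
  ring

lemma bF_hasDerivAt (n : ℕ) (y : ℝ) : HasDerivAt (bF n) (- bF (n + 1) y) y := by
  have hR : 0 < |y| + 1 := by positivity
  set R := |y| + 1 with hRdef
  have hu : Summable fun m : ℕ => (m : ℝ) * R ^ (m - 1) / Nat.factorial m := by
    rw [← summable_nat_add_iff 1]
    apply (Real.summable_pow_div_factorial R).congr
    intro m
    have h2 : ((m + 1 : ℕ) : ℝ) ≠ 0 := by positivity
    rw [Nat.factorial_succ, Nat.cast_mul, Nat.add_sub_cancel]
    field_simp
  have key := hasDerivAt_tsum_of_isPreconnected (𝕜 := ℝ) (F := ℝ)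
    (g := fun m y => bcoef n m * y ^ m) (g' := fun m y => bcoef n m * ((m : ℝ) * y ^ (m - 1)))
    (t := Metric.ball 0 R) (y₀ := 0) (y := y) hu Metric.isOpen_ball
    (convex_ball 0 R).isPreconnected
    (fun m z _ => (hasDerivAt_pow m z).const_mul _)
    (by
      intro m z hz
      rw [Metric.mem_ball, dist_zero_right, Real.norm_eq_abs] at hz
      rw [Real.norm_eq_abs, abs_mul, abs_mul, abs_pow, abs_of_nonneg (Nat.cast_nonneg m : (0 : ℝ) ≤ m)]
      calc _ ≤ (1 / (Nat.factorial m : ℝ)) * ((m : ℝ) * R ^ (m - 1)) := by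
            gcongr; exact abs_bcoef_le n m
        _ = _ := by ring)
    (Metric.mem_ball_self hR) (bF_summable n 0)
    (by rw [Metric.mem_ball, dist_zero_right, Real.norm_eq_abs]; linarith)
  have hs : (∑' m : ℕ, bcoef n m * ((m : ℝ) * y ^ (m - 1))) = - bF (n + 1) y := by
    have hsum : Summable fun m : ℕ => bcoef n m * ((m : ℝ) * y ^ (m - 1)) := by
      rw [← summable_nat_add_iff 1]
      apply (bF_summable (n + 1) y).neg.congr
      intro m
      rw [Nat.add_sub_cancel, ← mul_assoc, bcoef_succ]; ring
    rw [hsum.tsum_eq_zero_add]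
    unfold bF
    rw [← tsum_neg]
    simp only [Nat.cast_zero, zero_mul, mul_zero, zero_add]
    apply tsum_congr
    intro m
    rw [Nat.add_sub_cancel, ← mul_assoc, bcoef_succ]; ring
  rw [hs] at key
  exact key

lemma bF_rec (n : ℕ) (y : ℝ) : bF n y + y * bF (n + 2) y = (n + 1) * bF (n + 1) y := by
  have h1 : y * bF (n + 2) y = ∑' m : ℕ, (-(m : ℝ) * bcoef (n + 1) m * y ^ m) := by
    have hsum : Summable fun m : ℕ => (-(m : ℝ) * bcoef (n + 1) m * y ^ m) := by
      rw [← summable_nat_add_iff 1]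
      apply ((bF_summable (n + 2) y).mul_left y).congr
      intro m
      have := bcoef_succ (n + 1) m
      rw [show -((m + 1 : ℕ) : ℝ) * bcoef (n + 1) (m + 1) * y ^ (m + 1)
        = -(bcoef (n + 1) (m + 1) * ((m + 1 : ℕ) : ℝ)) * y ^ (m + 1) by ring, this]
      ring
    rw [hsum.tsum_eq_zero_add]
    unfold bF
    rw [← tsum_mul_left]
    simp only [Nat.cast_zero, neg_zero, zero_mul, zero_add]
    apply tsum_congr
    intro m
    have := bcoef_succ (n + 1) m
    rw [show -((m + 1 : ℕ) : ℝ) * bcoef (n + 1) (m + 1) * y ^ (m + 1)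
        = -(bcoef (n + 1) (m + 1) * ((m + 1 : ℕ) : ℝ)) * y ^ (m + 1) by ring, this]
    ring
  have h2 : bF n y = ∑' m : ℕ, ((m : ℝ) + n + 1) * bcoef (n + 1) m * y ^ m := by
    unfold bF
    apply tsum_congr
    intro m
    congr 1
    unfold bcoef
    have h3 : (Nat.factorial m : ℝ) ≠ 0 := by positivity
    have h4 : (Nat.factorial (m + n) : ℝ) ≠ 0 := by positivity
    have h5 : (m : ℝ) + n + 1 ≠ 0 := by positivity
    rw [show m + (n + 1) = (m + n) + 1 by ring, Nat.factorial_succ, Nat.cast_mul]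
    push_cast
    field_simp
  have hs2 : Summable fun m : ℕ => ((m : ℝ) + n + 1) * bcoef (n + 1) m * y ^ m := by
    apply (bF_summable n y).congr
    intro m
    congr 1
    unfold bcoef
    have h3 : (Nat.factorial m : ℝ) ≠ 0 := by positivity
    have h4 : (Nat.factorial (m + n) : ℝ) ≠ 0 := by positivity
    have h5 : (m : ℝ) + n + 1 ≠ 0 := by positivity
    rw [show m + (n + 1) = (m + n) + 1 by ring, Nat.factorial_succ, Nat.cast_mul]
    push_cast
    field_simp
  have hs1 : Summable fun m : ℕ => (-(m : ℝ) * bcoef (n + 1) m * y ^ m) := by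
    apply (((bF_summable (n + 1) y).mul_left ((n : ℝ) + 1)).sub hs2).congr
    intro m
    ring
  rw [h1, h2, ← hs2.tsum_add hs1]
  unfold bF
  rw [← tsum_mul_left]
  apply tsum_congr
  intro m
  ring

lemma besselJ_eq (n : ℕ) (x : ℝ) : besselJ n x = (x / 2) ^ n * bF n ((x / 2) ^ 2) := by
  unfold besselJ bF
  rw [← tsum_mul_left]
  apply tsum_congr
  intro m
  unfold bcoef
  rw [pow_add, pow_mul]
  ring

lemma bF_zero_ne (n : ℕ) : bF n 0 ≠ 0 := by
  unfold bF
  rw [tsum_eq_single 0 (by intro m hm; simp [hm])]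
  unfold bcoef
  simp
  positivity

lemma bF_cont (n : ℕ) : Continuous (bF n) :=
  continuous_iff_continuousAt.2 fun y => (bF_hasDerivAt n y).continuousAt

lemma besselJ_cont (n : ℕ) : Continuous (besselJ n) := by
  have : besselJ n = fun x => (x / 2) ^ n * bF n ((x / 2) ^ 2) := funext (besselJ_eq n)
  rw [this]
  have := bF_cont n
  fun_prop

lemma besselJ_rec (n : ℕ) {x : ℝ} (hx : x ≠ 0) :
    besselJ n x = 2 * (n + 1) / x * besselJ (n + 1) x - besselJ (n + 2) x := by
  rw [besselJ_eq, besselJ_eq, besselJ_eq]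
  have h := bF_rec n ((x / 2) ^ 2)
  have h' : bF n ((x / 2) ^ 2) = (n + 1) * bF (n + 1) ((x / 2) ^ 2)
    - (x / 2) ^ 2 * bF (n + 2) ((x / 2) ^ 2) := by linarith
  rw [h']
  field_simp
  ring

lemma hasDerivAt_G (n : ℕ) (x : ℝ) :
    HasDerivAt (fun x => bF n ((x / 2) ^ 2)) (-(x / 2) * bF (n + 1) ((x / 2) ^ 2)) x := by
  have h1 : HasDerivAt (fun x : ℝ => (x / 2) ^ 2) (x / 2) x := by
    have := ((hasDerivAt_id x).div_const 2).pow 2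
    refine HasDerivAt.congr_deriv this (Eq.symm ?_)
    simp; ring
  have := (bF_hasDerivAt n ((x / 2) ^ 2)).comp x h1
  refine HasDerivAt.congr_deriv this (Eq.symm ?_)
  ring

lemma besselJ_deriv (n : ℕ) {x : ℝ} (hx : x ≠ 0) :
    HasDerivAt (besselJ n) (n / x * besselJ n x - besselJ (n + 1) x) x := by
  have he : besselJ n = fun x => (x / 2) ^ n * bF n ((x / 2) ^ 2) := funext (besselJ_eq n)
  have h1 : HasDerivAt (fun x : ℝ => (x / 2) ^ n) (n / x * (x / 2) ^ n) x := by
    have := ((hasDerivAt_id x).div_const 2).pow n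
    refine HasDerivAt.congr_deriv this (Eq.symm ?_)
    rcases n with _ | n
    · simp
    · simp; field_simp; rw [pow_succ]; ring
  have := h1.mul (hasDerivAt_G n x)
  rw [besselJ_eq n x, besselJ_eq (n + 1) x, he]
  refine HasDerivAt.congr_deriv this (Eq.symm ?_)
  ring

lemma besselJ_deriv_succ (n : ℕ) {x : ℝ} (hx : x ≠ 0) :
    HasDerivAt (besselJ (n + 1)) (besselJ n x - (n + 1) / x * besselJ (n + 1) x) x := by
  have := besselJ_deriv (n + 1) hx
  refine HasDerivAt.congr_deriv this (Eq.symm ?_)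
  rw [besselJ_rec n hx]
  push_cast
  ring

lemma besselJ_zero_iff (n : ℕ) {x : ℝ} (hx : 0 < x) : besselJ n x = 0 ↔ bF n ((x / 2) ^ 2) = 0 := by
  rw [besselJ_eq, mul_eq_zero, or_iff_right]
  positivity

lemma not_zero_on (n : ℕ) {z : ℝ} (hz : 0 < z) (h : ∀ t, 0 < t → t < z → besselJ n t = 0) : False := by
  have hc : ContinuousAt (fun x : ℝ => bF n ((x / 2) ^ 2)) 0 := (hasDerivAt_G n 0).continuousAt
  have h0 : bF n (((0 : ℝ) / 2) ^ 2) ≠ 0 := by simpa using bF_zero_ne n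
  have h1 := hc.eventually_ne h0
  have h2 : ∀ᶠ x in nhdsWithin (0 : ℝ) (Set.Ioi 0), bF n ((x / 2) ^ 2) ≠ 0 := h1.filter_mono nhdsWithin_le_nhds
  have h3 : ∀ᶠ x in nhdsWithin (0 : ℝ) (Set.Ioi 0), x ∈ Set.Ioo 0 z := Ioo_mem_nhdsGT hz
  obtain ⟨t, ht, ht2⟩ := (h2.and h3).exists
  exact ht ((besselJ_zero_iff n ht2.1).1 (h t ht2.1 ht2.2))

lemma energy_mono (n : ℕ) : MonotoneOn
    (fun t => t ^ (2 * n + 2) * (besselJ n t ^ 2 + besselJ (n + 1) t ^ 2)) (Set.Ici 0) := by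
  have c1 := besselJ_cont n
  have c2 := besselJ_cont (n + 1)
  have hd : ∀ t : ℝ, 0 < t → HasDerivAt
      (fun t => t ^ (2 * n + 2) * (besselJ n t ^ 2 + besselJ (n + 1) t ^ 2))
      (t ^ (2 * n + 1) * ((4 * n + 2) * besselJ n t ^ 2)) t := by
    intro t ht
    have := (hasDerivAt_pow (2 * n + 2) t).mul
      (((besselJ_deriv n ht.ne').pow 2).add ((besselJ_deriv_succ n ht.ne').pow 2))
    refine HasDerivAt.congr_deriv this (Eq.symm ?_)
    simp
    rw [pow_succ t (2 * n + 1)]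
    field_simp
    ring
  apply monotoneOn_of_deriv_nonneg (convex_Ici 0) (by fun_prop)
  · rw [interior_Ici]
    intro t ht
    exact (hd t ht).differentiableAt.differentiableWithinAt
  · rw [interior_Ici]
    intro t ht
    have ht' : (0 : ℝ) < t := ht
    rw [(hd t ht).deriv]
    positivity

lemma nondegenerate (n : ℕ) {z : ℝ} (hz : 0 < z) (h1 : besselJ n z = 0) (h2 : besselJ (n + 1) z = 0) :
    False := by
  apply not_zero_on n hz
  intro t ht htz
  have := energy_mono n (Set.mem_Ici.2 ht.le) (Set.mem_Ici.2 hz.le) htz.le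
  simp only [h1, h2] at this
  have hp : 0 < t ^ (2 * n + 2) := by positivity
  have h3 : besselJ n t ^ 2 + besselJ (n + 1) t ^ 2 ≤ 0 := by
    by_contra hcon
    push Not at hcon
    have := mul_pos hp hcon
    simp at *
    linarith
  have : besselJ n t ^ 2 = 0 := by nlinarith [sq_nonneg (besselJ n t), sq_nonneg (besselJ (n + 1) t)]
  exact pow_eq_zero_iff (two_ne_zero) |>.1 this

lemma zero_gt (n : ℕ) (hn : 1 ≤ n) {z : ℝ} (hz : 0 < z) (h1 : besselJ n z = 0) : (n : ℝ) ≤ z := by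
  by_contra hlt
  push Not at hlt
  have c1 := besselJ_cont n
  have c2 := besselJ_cont (n + 1)
  have h00 : besselJ n 0 = 0 := by
    rw [besselJ_eq]; simp; left; omega
  have hd : ∀ t : ℝ, 0 < t → HasDerivAt
      (fun t => besselJ n t * (n * besselJ n t - t * besselJ (n + 1) t))
      ((n * besselJ n t - t * besselJ (n + 1) t) ^ 2 / t + besselJ n t ^ 2 * (n ^ 2 / t - t)) t := by
    intro t ht
    have := (besselJ_deriv n ht.ne').mul
      (((besselJ_deriv n ht.ne').const_mul (n : ℝ)).sub
        ((hasDerivAt_id t).mul (besselJ_deriv_succ n ht.ne')))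
    refine HasDerivAt.congr_deriv this (Eq.symm ?_)
    simp
    field_simp
    ring
  have hm : MonotoneOn (fun t => besselJ n t * (n * besselJ n t - t * besselJ (n + 1) t)) (Set.Icc 0 z) := by
    apply monotoneOn_of_deriv_nonneg (convex_Icc 0 z) (by fun_prop)
    · rw [interior_Icc]
      intro t ht
      exact (hd t ht.1).differentiableAt.differentiableWithinAt
    · rw [interior_Icc]
      intro t ht
      have ht' : (0 : ℝ) < t := ht.1
      rw [(hd t ht').deriv]
      have : 0 ≤ (n : ℝ) ^ 2 / t - t := by
        rw [sub_nonneg, le_div_iff₀ ht']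
        have := ht.2
        nlinarith
      positivity
  have hm2 : MonotoneOn (fun t => besselJ n t ^ 2) (Set.Icc 0 z) := by
    apply monotoneOn_of_deriv_nonneg (convex_Icc 0 z) (by fun_prop)
    · rw [interior_Icc]
      intro t ht
      exact ((besselJ_deriv n ht.1.ne').pow 2).differentiableAt.differentiableWithinAt
    · rw [interior_Icc]
      intro t ht
      have ht' : (0 : ℝ) < t := ht.1
      have h := hm (Set.left_mem_Icc.2 hz.le) (Set.Ioo_subset_Icc_self ht) ht'.le
      simp only [h00, zero_mul] at h
      have h2 : HasDerivAt (fun t => besselJ n t ^ 2)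
        (2 / t * (besselJ n t * (n * besselJ n t - t * besselJ (n + 1) t))) t := by
        refine HasDerivAt.congr_deriv ((besselJ_deriv n ht'.ne').pow 2) (Eq.symm ?_)
        simp
        field_simp
      rw [h2.deriv]
      positivity
  apply not_zero_on n hz
  intro t ht htz
  have h := hm2 ⟨ht.le, htz.le⟩ (Set.right_mem_Icc.2 hz.le) htz.le
  simp only [h1] at h
  exact pow_eq_zero_iff (two_ne_zero) |>.1 (le_antisymm (by simpa using h) (sq_nonneg _))

lemma next_zero (n : ℕ) {b : ℝ} (hb : 0 < b) (h1 : besselJ n b = 0) :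
    ∃ c, b < c ∧ c ≤ b + 2 ∧ besselJ (n + 1) c = 0 := by
  by_contra hcon
  push Not at hcon
  have hne : ∀ t ∈ Set.Icc b (b + 2), besselJ (n + 1) t ≠ 0 := by
    intro t ht
    rcases ht.1.eq_or_lt with rfl | h
    · intro h2; exact nondegenerate n hb h1 h2
    · exact hcon t h ht.2
  have c1 := besselJ_cont n
  have c2 := besselJ_cont (n + 1)
  set r : ℝ → ℝ := fun t => -besselJ n t / besselJ (n + 1) t with hr
  have hrb : r b = 0 := by simp [hr, h1]
  have hrd : ∀ t ∈ Set.Icc b (b + 2), HasDerivAt r (1 + r t ^ 2 + (2 * n + 1) / t * r t) t := by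
    intro t ht
    have ht0 : 0 < t := lt_of_lt_of_le hb ht.1
    have h3 := hne t ht
    have := (besselJ_deriv n ht0.ne').neg.div (besselJ_deriv_succ n ht0.ne') h3
    refine HasDerivAt.congr_deriv this (Eq.symm ?_)
    simp only [hr, Pi.neg_apply]
    field_simp
    ring
  have hrc : ContinuousOn r (Set.Icc b (b + 2)) := fun t ht => (hrd t ht).continuousAt.continuousWithinAt
  have hqm : MonotoneOn (fun t => (t ^ (2 * n + 1))⁻¹ * r t) (Set.Icc b (b + 2)) := by
    have hd : ∀ t ∈ Set.Icc b (b + 2), HasDerivAt (fun t => (t ^ (2 * n + 1))⁻¹ * r t)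
        ((t ^ (2 * n + 1))⁻¹ * (1 + r t ^ 2)) t := by
      intro t ht
      have ht0 : 0 < t := lt_of_lt_of_le hb ht.1
      have := ((hasDerivAt_pow (2 * n + 1) t).inv (by positivity)).mul (hrd t ht)
      refine HasDerivAt.congr_deriv this (Eq.symm ?_)
      simp
      field_simp
      ring
    apply monotoneOn_of_deriv_nonneg (convex_Icc _ _)
    · exact fun t ht => (hd t ht).continuousAt.continuousWithinAt
    · rw [interior_Icc]
      exact fun t ht => (hd t (Set.Ioo_subset_Icc_self ht)).differentiableAt.differentiableWithinAt
    · rw [interior_Icc]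
      intro t ht
      have ht0 : 0 < t := lt_trans hb ht.1
      rw [(hd t (Set.Ioo_subset_Icc_self ht)).deriv]
      positivity
  have hrn : ∀ t ∈ Set.Icc b (b + 2), 0 ≤ r t := by
    intro t ht
    have ht0 : 0 < t := lt_of_lt_of_le hb ht.1
    have := hqm (Set.left_mem_Icc.2 (by linarith)) ht ht.1
    simp only [hrb, mul_zero] at this
    exact nonneg_of_mul_nonneg_right this (by positivity)
  have ham : MonotoneOn (fun t => Real.arctan (r t) - t) (Set.Icc b (b + 2)) := by
    have hd : ∀ t ∈ Set.Icc b (b + 2), HasDerivAt (fun t => Real.arctan (r t) - t)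
        ((2 * n + 1) / t * r t / (1 + r t ^ 2)) t := by
      intro t ht
      have ht0 : 0 < t := lt_of_lt_of_le hb ht.1
      have := (hrd t ht).arctan.sub (hasDerivAt_id t)
      refine HasDerivAt.congr_deriv this (Eq.symm ?_)
      field_simp
      ring
    apply monotoneOn_of_deriv_nonneg (convex_Icc _ _)
    · exact fun t ht => (hd t ht).continuousAt.continuousWithinAt
    · rw [interior_Icc]
      exact fun t ht => (hd t (Set.Ioo_subset_Icc_self ht)).differentiableAt.differentiableWithinAt
    · rw [interior_Icc]
      intro t ht
      have ht0 : 0 < t := lt_trans hb ht.1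
      rw [(hd t (Set.Ioo_subset_Icc_self ht)).deriv]
      have := hrn t (Set.Ioo_subset_Icc_self ht)
      positivity
  have := ham (Set.left_mem_Icc.2 (by linarith)) (Set.right_mem_Icc.2 (by linarith)) (by linarith : b ≤ b + 2)
  simp only [hrb, Real.arctan_zero] at this
  have h2 := Real.arctan_lt_pi_div_two (r (b + 2))
  have h3 := Real.pi_lt_four
  linarith

lemma rolle_count (n : ℕ) (S : Finset ℝ) : (∀ s ∈ S, 0 < s ∧ besselJ n s = 0) →
    ∀ b, besselJ n b = 0 → 0 < b → (∀ s ∈ S, s < b) →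
    ∃ T : Finset ℝ, T.card = S.card ∧ ∀ t ∈ T, 0 < t ∧ t < b ∧ besselJ (n + 1) t = 0 := by
  induction S using Finset.induction_on_max with
  | empty => intro _ b _ _ _; exact ⟨∅, by simp⟩
  | insert a S ha ih =>
    intro hS b hb hb0 hlt
    have ha0 := hS a (Finset.mem_insert_self _ _)
    have hab := hlt a (Finset.mem_insert_self _ _)
    obtain ⟨T, hT, hT2⟩ := ih (fun s hs => hS s (Finset.mem_insert_of_mem hs)) a ha0.2 ha0.1 ha
    obtain ⟨c, hc, hc2⟩ := exists_hasDerivAt_eq_zero (f := fun x => bF n ((x / 2) ^ 2))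
      (f' := fun x => -(x / 2) * bF (n + 1) ((x / 2) ^ 2)) hab
      (fun x _ => (hasDerivAt_G n x).continuousAt.continuousWithinAt)
      (by rw [(besselJ_zero_iff n ha0.1).1 ha0.2, (besselJ_zero_iff n hb0).1 hb])
      (fun x _ => hasDerivAt_G n x)
    have hc0 : 0 < c := ha0.1.trans hc.1
    have hc3 : besselJ (n + 1) c = 0 := by
      rw [besselJ_zero_iff _ hc0]
      rcases mul_eq_zero.1 hc2 with h | h
      · linarith
      · exact h
    refine ⟨insert c T, ?_, ?_⟩
    · rw [Finset.card_insert_of_notMem, Finset.card_insert_of_notMem, hT]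
      · intro h; exact lt_irrefl _ (ha a h)
      · intro h; exact lt_asymm hc.1 (hT2 c h).2.1
    · intro t ht
      rcases Finset.mem_insert.1 ht with rfl | ht
      · exact ⟨hc0, hc.2, hc3⟩
      · obtain ⟨h1, h2, h3⟩ := hT2 t ht
        exact ⟨h1, h2.trans hab, h3⟩

lemma zeros_finite (n : ℕ) (a : ℝ) : {y : ℝ | 0 < y ∧ y < a ∧ besselJ n y = 0}.Finite := by
  by_contra hinf
  obtain ⟨x, hx, hacc⟩ := Set.Infinite.exists_accPt_of_subset_isCompact hinf
    (isCompact_Icc (a := (0 : ℝ)) (b := a)) (fun y hy => ⟨hy.1.le, hy.2.1.le⟩)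
  have hfr : ∃ᶠ y in nhdsWithin x {x}ᶜ, bF n ((y / 2) ^ 2) = 0 := by
    rw [accPt_iff_frequently_nhdsNE] at hacc
    exact hacc.mono fun y hy => (besselJ_zero_iff n hy.1).1 hy.2.2
  have hx0 : bF n ((x / 2) ^ 2) = 0 := by
    by_contra h
    have := ((hasDerivAt_G n x).continuousAt.eventually_ne h).filter_mono
      (nhdsWithin_le_nhds (s := {x}ᶜ))
    exact hfr this
  have hxp : 0 < x := by
    rcases hx.1.eq_or_lt with rfl | h
    · exfalso; apply bF_zero_ne n; simpa using hx0
    · exact h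
  have hne : -(x / 2) * bF (n + 1) ((x / 2) ^ 2) ≠ 0 := by
    intro h
    rcases mul_eq_zero.1 h with h | h
    · linarith
    · exact nondegenerate n hxp ((besselJ_zero_iff n hxp).2 hx0) ((besselJ_zero_iff _ hxp).2 h)
  exact hfr ((hasDerivAt_G n x).eventually_ne hne)

lemma gap (n k : ℕ) (hk : 1 ≤ k) {a b : ℝ} (ha : IsKthPosZero (besselJ (n + 1)) k a)
    (hb : IsKthPosZero (besselJ n) k b) : a ≤ b + 2 := by
  by_contra hlt
  push Not at hlt
  obtain ⟨ha0, ha1, ha2⟩ := ha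
  obtain ⟨hb0, hb1, hb2⟩ := hb
  have hf := zeros_finite n b
  obtain ⟨T, hT, hT2⟩ := rolle_count n hf.toFinset
    (fun s hs => by have := hf.mem_toFinset.1 hs; exact ⟨this.1, this.2.2⟩) b hb1 hb0
    (fun s hs => (hf.mem_toFinset.1 hs).2.1)
  rw [← Set.ncard_eq_toFinset_card _ hf, hb2] at hT
  obtain ⟨c, hc1, hc2, hc3⟩ := next_zero n hb0 hb1
  have hcT : c ∉ T := fun h => lt_asymm hc1 (hT2 c h).2.1
  have hsub : ((insert c T : Finset ℝ) : Set ℝ) ⊆ {y : ℝ | 0 < y ∧ y < a ∧ besselJ (n + 1) y = 0} := by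
    intro t ht
    rcases Finset.mem_insert.1 (Finset.mem_coe.1 ht) with rfl | ht
    · exact ⟨hb0.trans hc1, by linarith, hc3⟩
    · obtain ⟨h1, h2, h3⟩ := hT2 t ht
      exact ⟨h1, by linarith, h3⟩
  have := Set.ncard_le_ncard hsub (zeros_finite (n + 1) a)
  rw [Set.ncard_coe_finset, Finset.card_insert_of_notMem hcT, hT, ha2] at this
  omega

theorem besselJ_pred_ratio_bound (j : ℕ → ℕ → ℝ)
    (hj : ∀ n k, 1 ≤ k → IsKthPosZero (besselJ n) k (j n k)) :
    ∃ C : ℝ, 0 < C ∧ ∀ (n k : ℕ), 1 ≤ n → 1 ≤ k → k ≤ n → ∀ x : ℝ,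
      j n k / j (n + 1) k < x → x < 1 →
      |besselJ (n - 1) (j (n + 1) k * x)| ≤ C * |besselJ n (j (n + 1) k)| := by
  refine ⟨3 * Real.exp 4, by positivity, ?_⟩
  intro n k hn hk _ x hx1 hx2
  have hA := hj (n + 1) k hk
  have hB := hj n k hk
  set a := j (n + 1) k
  set b := j n k
  have hgap := gap n k hk hA hB
  have hbn := zero_gt n hn hB.1 hB.2.1
  have ha0 := hA.1
  have hb0 := hB.1
  rw [div_lt_iff₀ ha0] at hx1
  have hbt : b < a * x := by linarith
  have hta : a * x < a := by nlinarith
  generalize a * x = t at hbt hta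
  have ht0 : 0 < t := hb0.trans hbt
  have hn1 : (1 : ℝ) ≤ n := by exact_mod_cast hn
  have hE := energy_mono n (Set.mem_Ici.2 ht0.le) (Set.mem_Ici.2 ha0.le) hta.le
  simp only [hA.2.1] at hE
  have hratio : (a / t) ^ (n + 1) ≤ Real.exp 4 := by
    have h1 : a / t ≤ Real.exp (2 / n) := by
      calc a / t ≤ 2 / n + 1 := by
            rw [div_le_iff₀ ht0]
            have : 2 ≤ 2 / (n : ℝ) * t := by
              rw [div_mul_eq_mul_div, le_div_iff₀ (by linarith)]
              nlinarith
            linarith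
        _ ≤ _ := Real.add_one_le_exp _
    calc (a / t) ^ (n + 1) ≤ Real.exp (2 / n) ^ (n + 1) := by gcongr
      _ = Real.exp ((n + 1 : ℕ) * (2 / n)) := by rw [← Real.exp_nat_mul]
      _ ≤ _ := by
        apply Real.exp_le_exp.2
        push_cast
        rw [mul_div_assoc', div_le_iff₀ (by linarith)]
        linarith
  set M := Real.exp 4 * |besselJ n a| with hM
  have hsq : besselJ n t ^ 2 + besselJ (n + 1) t ^ 2 ≤ M ^ 2 := by
    have h1 : besselJ n t ^ 2 + besselJ (n + 1) t ^ 2 ≤ ((a / t) ^ (n + 1) * |besselJ n a|) ^ 2 := by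
      have hp : 0 < t ^ (2 * n + 2) := by positivity
      have : ((a / t) ^ (n + 1) * |besselJ n a|) ^ 2
        = a ^ (2 * n + 2) * (besselJ n a ^ 2 + 0 ^ 2) / t ^ (2 * n + 2) := by
        rw [mul_pow, sq_abs, div_pow, div_pow, ← pow_mul, ← pow_mul]
        ring_nf
      rw [this, le_div_iff₀ hp]
      linarith
    refine h1.trans ?_
    rw [hM]
    gcongr
  have hM0 : 0 ≤ M := by positivity
  have hu : |besselJ n t| ≤ M := abs_le_of_sq_le_sq (by nlinarith [sq_nonneg (besselJ (n + 1) t)]) hM0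
  have hv : |besselJ (n + 1) t| ≤ M := abs_le_of_sq_le_sq (by nlinarith [sq_nonneg (besselJ n t)]) hM0
  obtain ⟨m, rfl⟩ : ∃ m, n = m + 1 := ⟨n - 1, by omega⟩
  rw [Nat.add_sub_cancel, besselJ_rec m ht0.ne']
  have h2 : 2 * ((m : ℝ) + 1) / t ≤ 2 := by
    rw [div_le_iff₀ ht0]
    push_cast at hbn
    linarith
  calc _ ≤ |2 * ((m : ℝ) + 1) / t * besselJ (m + 1) t| + |besselJ (m + 2) t| := abs_sub _ _
    _ ≤ 2 * M + M := by
      rw [abs_mul, abs_of_pos (by positivity : 0 < 2 * ((m : ℝ) + 1) / t)]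
      gcongr
    _ = _ := by rw [hM]; ring
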